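/- Fix a constant ρ > 0 and suppose the probability measure μ on [−2,2] satisfies the free Poincaré inequality 2ρ·∬ ((f(x)−f(y))/(x−y))² ω(dx dy) ≤ ∫ (f')² dμ for all smooth f on [−2,2]. Then ρ ≤ 1/2, with equality forcing μ to be the semicircle law α on [−2,2]. -/

import Mathlib

open MeasureTheory Real

/-- The semicircle law on `[-2,2]`. -/
noncomputable def semicircleLaw : Measure ℝ :=
  (volume.restrict (Set.Icc (-2 : ℝ) 2)).withDensity
    fun x => ENNReal.ofReal (Real.sqrt (4 - x ^ 2) / (2 * π))

/-- The measure `ω` on `[-2,2]²` with density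
`(4 - xy)/(4π² √((4-x²)(4-y²)))` w.r.t. Lebesgue measure. -/
noncomputable def omegaMeasure : Measure (ℝ × ℝ) :=
  (volume.restrict ((Set.Icc (-2 : ℝ) 2) ×ˢ (Set.Icc (-2 : ℝ) 2))).withDensity
    fun p => ENNReal.ofReal
      ((4 - p.1 * p.2) / (4 * π ^ 2 * Real.sqrt ((4 - p.1 ^ 2) * (4 - p.2 ^ 2))))

/-- The arcsine law on `[-2,2]`. -/
noncomputable def arcsineLaw : Measure ℝ :=
  (volume.restrict (Set.Icc (-2 : ℝ) 2)).withDensity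
    fun x => ENNReal.ofReal (1 / (π * Real.sqrt (4 - x ^ 2)))

theorem Continuous.integrable_of_ae_mem_isCompact {X : Type*} [TopologicalSpace X]
    [MeasurableSpace X] [OpensMeasurableSpace X] {ν : Measure X} [IsFiniteMeasure ν]
    {K : Set X} (hK : IsCompact K) (hν : ∀ᵐ x ∂ν, x ∈ K) {f : X → ℝ} (hf : Continuous f) :
    Integrable f ν := by
  obtain ⟨C, hC⟩ := hK.exists_bound_of_continuousOn hf.continuousOn
  exact Integrable.of_bound hf.measurable.aestronglyMeasurable C (hν.mono fun x hx => hC x hx)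

/-- Finite measures on a compact interval are determined by their moments. -/
theorem MeasureTheory.Measure.ext_of_forall_moment_eq {a b : ℝ} {μ ν : Measure ℝ}
    [IsFiniteMeasure μ] [IsFiniteMeasure ν] (hμ : ∀ᵐ x ∂μ, x ∈ Set.Icc a b)
    (hν : ∀ᵐ x ∂ν, x ∈ Set.Icc a b) (h : ∀ n : ℕ, ∫ x, x ^ n ∂μ = ∫ x, x ^ n ∂ν) : μ = ν := by
  have integrable_of_continuous {m : Measure ℝ} [IsFiniteMeasure m]
      (hm : ∀ᵐ x ∂m, x ∈ Set.Icc a b) {f : ℝ → ℝ} (hf : Continuous f) : Integrable f m :=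
    hf.integrable_of_ae_mem_isCompact isCompact_Icc hm
  have hpoly (p : Polynomial ℝ) : ∫ x, p.eval x ∂μ = ∫ x, p.eval x ∂ν := by
    simp_rw [Polynomial.eval_eq_sum_range]
    rw [integral_finsetSum, integral_finsetSum]
    · simp_rw [integral_const_mul, h]
    · exact fun i _ => integrable_of_continuous hν (by fun_prop)
    · exact fun i _ => integrable_of_continuous hμ (by fun_prop)
  refine ext_of_forall_integral_eq_of_IsFiniteMeasure fun f => ?_
  have approx {m : Measure ℝ} [IsFiniteMeasure m] (hm : ∀ᵐ x ∂m, x ∈ Set.Icc a b) {ε : ℝ}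
      {p : Polynomial ℝ} (hp : ∀ x ∈ Set.Icc a b, |p.eval x - f x| < ε) :
      |∫ x, p.eval x ∂m - ∫ x, f x ∂m| ≤ ε * m.real Set.univ := by
    rw [← integral_sub (integrable_of_continuous hm p.continuous)
      (integrable_of_continuous hm f.continuous)]
    simpa only [Real.norm_eq_abs] using norm_integral_le_of_norm_le_const
      (f := fun x => p.eval x - f x) (hm.mono fun x hx => (hp x hx).le)
  set M : ℝ := μ.real Set.univ + ν.real Set.univ + 1 with hM
  have hM0 : 0 < M := by positivity
  refine eq_of_abs_sub_le_all fun ε hε => ?_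
  obtain ⟨p, hp⟩ := exists_polynomial_near_of_continuousOn a b f f.continuous.continuousOn
    (ε / M) (div_pos hε hM0)
  have h₁ := abs_le.mp (approx hμ hp)
  have h₂ := abs_le.mp (approx hν hp)
  have h₃ := hpoly p
  have h₄ : ε / M * μ.real Set.univ + ε / M * ν.real Set.univ + ε / M = ε := by
    rw [← mul_add, ← mul_add_one, ← hM]
    field_simp
  have h₅ : 0 < ε / M := div_pos hε hM0
  rw [abs_le]
  constructor <;> linarith

theorem eq_zero_of_forall_mul_add_sq_mul_nonpos {a b : ℝ}
    (h : ∀ t : ℝ, t * a + t ^ 2 * b ≤ 0) : a = 0 := by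
  by_contra ha
  have hb : 0 < |b| + 1 := by positivity
  have key := h (a / (|b| + 1))
  have : a / (|b| + 1) * a + (a / (|b| + 1)) ^ 2 * b
      = a ^ 2 * (|b| + 1 + b) / (|b| + 1) ^ 2 := by
    field_simp
  rw [this] at key
  have : 0 < |b| + 1 + b := by linarith [neg_abs_le b]
  have : 0 < a ^ 2 * (|b| + 1 + b) / (|b| + 1) ^ 2 := by positivity
  linarith

section Convolution

open Finset

variable {a : ℕ → ℝ}

theorem two_mul_sum_antidiagonal_fst_mul (a : ℕ → ℝ) (n : ℕ) :
    2 * ∑ p ∈ antidiagonal n, (p.1 : ℝ) * (a p.1 * a p.2) =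
      n * ∑ p ∈ antidiagonal n, a p.1 * a p.2 := by
  have hswap : ∑ p ∈ antidiagonal n, (p.1 : ℝ) * (a p.1 * a p.2) =
      ∑ p ∈ antidiagonal n, (p.2 : ℝ) * (a p.1 * a p.2) := by
    rw [← Finset.Nat.sum_antidiagonal_swap]
    exact sum_congr rfl fun p _ => by simp only [Prod.fst_swap, Prod.snd_swap]; ring
  rw [two_mul]
  nth_rewrite 2 [hswap]
  rw [← sum_add_distrib, mul_sum]
  refine sum_congr rfl fun p hp => ?_
  rw [← mem_antidiagonal.mp hp]
  push_cast
  ring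

theorem sum_antidiagonal_add_two_eq_four_mul (h₁ : a 1 = 0)
    (h : ∀ k : ℕ, (k + 2) * a (k + 2) = 4 * (k + 1) * a k) (n : ℕ) :
    ∑ p ∈ antidiagonal (n + 2), a p.1 * a p.2 = 4 * ∑ p ∈ antidiagonal n, a p.1 * a p.2 := by
  have hlhs := two_mul_sum_antidiagonal_fst_mul a (n + 2)
  have hrhs := two_mul_sum_antidiagonal_fst_mul a n
  have hshift : ∑ p ∈ antidiagonal (n + 2), (p.1 : ℝ) * (a p.1 * a p.2) =
      4 * ∑ p ∈ antidiagonal n, (p.1 : ℝ) * (a p.1 * a p.2)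
        + 4 * ∑ p ∈ antidiagonal n, a p.1 * a p.2 := by
    rw [Finset.Nat.sum_antidiagonal_succ, Finset.Nat.sum_antidiagonal_succ, mul_sum, mul_sum,
      ← sum_add_distrib]
    simp only [Nat.cast_zero, zero_mul, zero_add, h₁, mul_zero]
    refine sum_congr rfl fun p _ => ?_
    have := h p.1
    push_cast
    linear_combination a p.2 * this
  have hn : (n + 2 : ℝ) ≠ 0 := by positivity
  apply mul_left_cancel₀ hn
  push_cast at hlhs
  linear_combination -hlhs + 2 * hshift + 4 * hrhs

theorem sum_antidiagonal_sub_shift_eq (h₀ : a 0 = 1) (h₁ : a 1 = 0)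
    (h : ∀ k : ℕ, (k + 2) * a (k + 2) = 4 * (k + 1) * a k) (n : ℕ) :
    ∑ p ∈ antidiagonal n, (a p.1 * a p.2 - a (p.1 + 1) * a (p.2 + 1) / 4) = a (n + 2) / 2 := by
  have key := sum_antidiagonal_add_two_eq_four_mul h₁ h n
  rw [Finset.Nat.sum_antidiagonal_succ, Finset.Nat.sum_antidiagonal_succ'] at key
  simp only [h₀] at key
  rw [sum_sub_distrib, ← sum_div]
  linear_combination -key / 4

end Convolution

theorem four_sub_sq_pos {x : ℝ} (hx : x ∈ Set.Ioo (-2 : ℝ) 2) : 0 < 4 - x ^ 2 := by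
  nlinarith [hx.1, hx.2]

theorem integrableOn_and_integral_one_div_sqrt_four_sub_sq :
    IntegrableOn (fun x : ℝ => 1 / Real.sqrt (4 - x ^ 2)) (Set.Icc (-2) 2) ∧
      ∫ x in Set.Icc (-2 : ℝ) 2, 1 / Real.sqrt (4 - x ^ 2) = π := by
  have hcont : ContinuousOn (fun x : ℝ => arcsin (x / 2)) (Set.Icc (-2) 2) := by fun_prop
  have hderiv : ∀ x ∈ Set.Ioo (-2 : ℝ) 2,
      HasDerivAt (fun x : ℝ => arcsin (x / 2)) (1 / Real.sqrt (4 - x ^ 2)) x := by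
    intro x hx
    have h := (hasDerivAt_arcsin (x := x / 2) (by linarith [hx.1]) (by linarith [hx.2])).comp x
      ((hasDerivAt_id x).div_const 2)
    convert! h using 1
    have : 4 - x ^ 2 = 2 ^ 2 * (1 - (x / 2) ^ 2) := by ring
    rw [this, Real.sqrt_mul (by norm_num), Real.sqrt_sq (by norm_num)]
    field_simp
  have hint := intervalIntegral.integrableOn_deriv_of_nonneg hcont hderiv
    fun x _ => by positivity
  refine ⟨(integrableOn_Icc_iff_integrableOn_Ioc (by finiteness)).mpr hint, ?_⟩
  rw [integral_Icc_eq_integral_Ioc, ← intervalIntegral.integral_of_le (by norm_num),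
    intervalIntegral.integral_eq_sub_of_hasDerivAt_of_le (by norm_num) hcont hderiv
      ((intervalIntegrable_iff_integrableOn_Ioc_of_le (by norm_num)).mpr hint)]
  norm_num

theorem integral_arcsineLaw (f : ℝ → ℝ) :
    ∫ x, f x ∂arcsineLaw = ∫ x in Set.Icc (-2 : ℝ) 2, f x / (π * Real.sqrt (4 - x ^ 2)) := by
  rw [arcsineLaw, integral_withDensity_eq_integral_toReal_smul (by fun_prop)
    (Filter.Eventually.of_forall fun _ => ENNReal.ofReal_lt_top)]
  refine integral_congr_ae (Filter.Eventually.of_forall fun x => ?_)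
  simp only [smul_eq_mul]
  rw [ENNReal.toReal_ofReal (by positivity)]
  ring

theorem ae_arcsineLaw_mem_Icc : ∀ᵐ x ∂arcsineLaw, x ∈ Set.Icc (-2 : ℝ) 2 :=
  (withDensity_absolutelyContinuous _ _).ae_le (ae_restrict_mem measurableSet_Icc)

instance : IsFiniteMeasure arcsineLaw := by
  refine isFiniteMeasure_withDensity_ofReal ?_
  convert! (integrableOn_and_integral_one_div_sqrt_four_sub_sq.1.const_mul π⁻¹).2 using 2 with x
  simp [mul_comm]

theorem integral_pow_zero_arcsineLaw : ∫ x, x ^ 0 ∂arcsineLaw = 1 := by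
  rw [integral_arcsineLaw]
  have : (fun x : ℝ => x ^ 0 / (π * Real.sqrt (4 - x ^ 2))) =
      fun x => π⁻¹ * (1 / Real.sqrt (4 - x ^ 2)) := by
    ext x
    rw [pow_zero]
    field_simp
  rw [this, integral_const_mul, integrableOn_and_integral_one_div_sqrt_four_sub_sq.2]
  exact inv_mul_cancel₀ pi_ne_zero

instance : IsProbabilityMeasure arcsineLaw := by
  have h := integral_pow_zero_arcsineLaw
  simp only [pow_zero, integral_const, smul_eq_mul, mul_one] at h
  exact ⟨by rw [← ENNReal.toReal_eq_one_iff]; exact h⟩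

theorem Continuous.integrable_arcsineLaw {f : ℝ → ℝ} (hf : Continuous f) :
    Integrable f arcsineLaw :=
  hf.integrable_of_ae_mem_isCompact isCompact_Icc ae_arcsineLaw_mem_Icc

theorem integrableOn_div_sqrt_four_sub_sq {f : ℝ → ℝ} (hf : Continuous f) :
    IntegrableOn (fun x : ℝ => f x / Real.sqrt (4 - x ^ 2)) (Set.Icc (-2) 2) := by
  convert! integrableOn_and_integral_one_div_sqrt_four_sub_sq.1.continuousOn_mul hf.continuousOn isCompact_Icc
    using 2 with x
  ring

/-- The fundamental theorem of calculus against the arcsine law. -/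
theorem integral_arcsineLaw_of_hasDerivAt {F f : ℝ → ℝ} (hF : Continuous F) (hf : Continuous f)
    (hderiv : ∀ x ∈ Set.Ioo (-2 : ℝ) 2, HasDerivAt F (f x / Real.sqrt (4 - x ^ 2)) x) :
    ∫ x, f x ∂arcsineLaw = π⁻¹ * (F 2 - F (-2)) := by
  rw [← intervalIntegral.integral_eq_sub_of_hasDerivAt_of_le (by norm_num) hF.continuousOn hderiv
    ((intervalIntegrable_iff_integrableOn_Icc_of_le (by norm_num)).mpr
      (integrableOn_div_sqrt_four_sub_sq hf)),
    intervalIntegral.integral_of_le (by norm_num), ← integral_Icc_eq_integral_Ioc,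
    ← integral_const_mul, integral_arcsineLaw]
  refine integral_congr_ae (Filter.Eventually.of_forall fun x => ?_)
  simp only [div_eq_mul_inv, mul_inv]
  ring

theorem hasDerivAt_sqrt_four_sub_sq {x : ℝ} (hx : x ∈ Set.Ioo (-2 : ℝ) 2) :
    HasDerivAt (fun x : ℝ => Real.sqrt (4 - x ^ 2)) (-x / Real.sqrt (4 - x ^ 2)) x := by
  convert! (((hasDerivAt_pow 2 x).const_sub 4).sqrt (four_sub_sq_pos hx).ne') using 1
  push_cast
  field_simp

theorem integral_pow_one_arcsineLaw : ∫ x, x ^ 1 ∂arcsineLaw = 0 := by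
  rw [integral_arcsineLaw_of_hasDerivAt (F := fun x => -Real.sqrt (4 - x ^ 2)) (by fun_prop)
    (by fun_prop)]
  · norm_num
  · intro x hx
    convert! (hasDerivAt_sqrt_four_sub_sq hx).neg using 1
    ring

theorem integral_pow_add_two_arcsineLaw (k : ℕ) :
    (k + 2) * ∫ x, x ^ (k + 2) ∂arcsineLaw = 4 * (k + 1) * ∫ x, x ^ k ∂arcsineLaw := by
  have h := integral_arcsineLaw_of_hasDerivAt
    (F := fun x => x ^ (k + 1) * Real.sqrt (4 - x ^ 2))
    (f := fun x => 4 * (k + 1) * x ^ k - (k + 2) * x ^ (k + 2)) (by fun_prop) (by fun_prop) ?_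
  · rw [integral_sub (Continuous.integrable_arcsineLaw (by fun_prop))
      (Continuous.integrable_arcsineLaw (by fun_prop)), integral_const_mul,
      integral_const_mul] at h
    norm_num at h
    linarith
  · intro x hx
    have hpos := four_sub_sq_pos hx
    convert! (hasDerivAt_pow (k + 1) x).mul (hasDerivAt_sqrt_four_sub_sq hx) using 1
    have hs := Real.sq_sqrt hpos.le
    have hs0 := (Real.sqrt_pos.mpr hpos).ne'
    field_simp
    rw [hs]
    push_cast
    ring

theorem ae_semicircleLaw_mem_Icc : ∀ᵐ x ∂semicircleLaw, x ∈ Set.Icc (-2 : ℝ) 2 :=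
  (withDensity_absolutelyContinuous _ _).ae_le (ae_restrict_mem measurableSet_Icc)

instance : IsFiniteMeasure semicircleLaw :=
  isFiniteMeasure_withDensity_ofReal
    ((by fun_prop : Continuous fun x : ℝ => Real.sqrt (4 - x ^ 2) / (2 * π)).integrableOn_Icc).2

theorem integral_semicircleLaw (f : ℝ → ℝ) :
    ∫ x, f x ∂semicircleLaw = ∫ x, (4 - x ^ 2) / 2 * f x ∂arcsineLaw := by
  rw [integral_arcsineLaw, semicircleLaw,
    integral_withDensity_eq_integral_toReal_smul (by fun_prop) (by simp)]
  refine integral_congr_ae (Filter.Eventually.of_forall fun x => ?_)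
  simp only [smul_eq_mul]
  rw [ENNReal.toReal_ofReal (by positivity)]
  rcases le_or_gt (4 - x ^ 2) 0 with h | h
  · simp [Real.sqrt_eq_zero_of_nonpos h]
  · have hs := Real.sq_sqrt h.le
    have hs0 := (Real.sqrt_pos.mpr h).ne'
    field_simp
    rw [hs]

theorem integral_pow_semicircleLaw (n : ℕ) :
    (n + 1) * ∫ x, x ^ n ∂semicircleLaw = (∫ x, x ^ (n + 2) ∂arcsineLaw) / 2 := by
  have h : ∫ x, x ^ n ∂semicircleLaw =
      2 * ∫ x, x ^ n ∂arcsineLaw - (∫ x, x ^ (n + 2) ∂arcsineLaw) / 2 := by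
    rw [integral_semicircleLaw, ← integral_const_mul, ← integral_div,
      ← integral_sub (Continuous.integrable_arcsineLaw (by fun_prop))
        (Continuous.integrable_arcsineLaw (by fun_prop))]
    congr 1 with x
    ring
  have := integral_pow_add_two_arcsineLaw n
  rw [h]
  linarith

theorem omegaMeasure_eq_withDensity :
    omegaMeasure = (arcsineLaw.prod arcsineLaw).withDensity
      fun p => ENNReal.ofReal ((4 - p.1 * p.2) / 4) := by
  rw [arcsineLaw, prod_withDensity (by fun_prop) (by fun_prop), Measure.prod_restrict,
    ← Measure.volume_eq_prod, ← withDensity_mul _ (by fun_prop) (by fun_prop), omegaMeasure]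
  refine withDensity_congr_ae ?_
  filter_upwards [ae_restrict_mem (measurableSet_Icc.prod measurableSet_Icc)] with p hp
  have h₁ : 0 ≤ 4 - p.1 ^ 2 := by nlinarith [hp.1.1, hp.1.2]
  simp only [Pi.mul_apply]
  rw [← ENNReal.ofReal_mul (by positivity), ← ENNReal.ofReal_mul (by positivity),
    Real.sqrt_mul h₁]
  congr 1
  simp only [div_eq_mul_inv, mul_inv]
  ring

theorem ae_prod_arcsineLaw_mem : ∀ᵐ p ∂arcsineLaw.prod arcsineLaw,
    p ∈ Set.Icc (-2 : ℝ) 2 ×ˢ Set.Icc (-2 : ℝ) 2 := by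
  filter_upwards [Measure.quasiMeasurePreserving_fst.ae ae_arcsineLaw_mem_Icc,
    Measure.quasiMeasurePreserving_snd.ae ae_arcsineLaw_mem_Icc] with p h₁ h₂
  exact ⟨h₁, h₂⟩

theorem Continuous.integrable_prod_arcsineLaw {f : ℝ × ℝ → ℝ} (hf : Continuous f) :
    Integrable f (arcsineLaw.prod arcsineLaw) :=
  hf.integrable_of_ae_mem_isCompact (isCompact_Icc.prod isCompact_Icc) ae_prod_arcsineLaw_mem

theorem integral_omegaMeasure (f : ℝ × ℝ → ℝ) :
    ∫ p, f p ∂omegaMeasure =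
      ∫ p, (4 - p.1 * p.2) / 4 * f p ∂arcsineLaw.prod arcsineLaw := by
  rw [omegaMeasure_eq_withDensity,
    integral_withDensity_eq_integral_toReal_smul (by fun_prop) (by simp)]
  refine integral_congr_ae ?_
  filter_upwards [ae_prod_arcsineLaw_mem] with p hp
  rw [smul_eq_mul, ENNReal.toReal_ofReal]
  nlinarith [hp.1.1, hp.1.2, hp.2.1, hp.2.2]

instance : IsFiniteMeasure omegaMeasure := by
  rw [omegaMeasure_eq_withDensity]
  exact isFiniteMeasure_withDensity_ofReal
    (Continuous.integrable_prod_arcsineLaw (by fun_prop)).2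

theorem ae_omegaMeasure_mem : ∀ᵐ p ∂omegaMeasure,
    p ∈ Set.Icc (-2 : ℝ) 2 ×ˢ Set.Icc (-2 : ℝ) 2 :=
  (withDensity_absolutelyContinuous _ _).ae_le
    (ae_restrict_mem (measurableSet_Icc.prod measurableSet_Icc))

theorem Continuous.integrable_omegaMeasure {f : ℝ × ℝ → ℝ} (hf : Continuous f) :
    Integrable f omegaMeasure :=
  hf.integrable_of_ae_mem_isCompact (isCompact_Icc.prod isCompact_Icc) ae_omegaMeasure_mem

theorem ae_omegaMeasure_fst_ne_snd : ∀ᵐ p ∂omegaMeasure, p.1 ≠ p.2 := by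
  have hmeas : MeasurableSet {p : ℝ × ℝ | p.1 ≠ p.2} :=
    (measurableSet_eq_fun measurable_fst measurable_snd).compl
  refine ((withDensity_absolutelyContinuous _ _).trans
    Measure.absolutelyContinuous_restrict).ae_le ((Measure.ae_prod_iff_ae_ae hmeas).mpr ?_)
  exact Filter.Eventually.of_forall fun x =>
    (Measure.ae_ne volume x).mono fun y hy => hy.symm

open Finset in
theorem integral_sum_antidiagonal_omegaMeasure (n : ℕ) :
    ∫ p, ∑ q ∈ antidiagonal n, p.1 ^ q.1 * p.2 ^ q.2 ∂omegaMeasure =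
      (∫ x, x ^ (n + 2) ∂arcsineLaw) / 2 := by
  rw [← sum_antidiagonal_sub_shift_eq (a := fun k => ∫ x, x ^ k ∂arcsineLaw)
    integral_pow_zero_arcsineLaw integral_pow_one_arcsineLaw integral_pow_add_two_arcsineLaw,
    integral_omegaMeasure]
  simp_rw [mul_sum]
  rw [integral_finsetSum _ fun q _ => Continuous.integrable_prod_arcsineLaw (by fun_prop)]
  refine sum_congr rfl fun q _ => ?_
  rw [← integral_prod_mul, ← integral_prod_mul, ← integral_div,
    ← integral_sub (Continuous.integrable_prod_arcsineLaw (by fun_prop))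
      (Continuous.integrable_prod_arcsineLaw (by fun_prop))]
  congr 1 with p
  ring

theorem integral_one_omegaMeasure : ∫ _, (1 : ℝ) ∂omegaMeasure = 1 := by
  have h := integral_sum_antidiagonal_omegaMeasure 0
  have h₂ := integral_pow_add_two_arcsineLaw 0
  have h₀ := integral_pow_zero_arcsineLaw
  simp only [Finset.Nat.antidiagonal_zero, Finset.sum_singleton, pow_zero, mul_one] at h
  rw [h₀] at h₂
  norm_num at h₂ h ⊢
  linarith

open Finset in
theorem pow_succ_sub_pow_succ_eq (x y : ℝ) (n : ℕ) :
    x ^ (n + 1) - y ^ (n + 1) = (∑ q ∈ antidiagonal n, x ^ q.1 * y ^ q.2) * (x - y) := by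
  rw [Finset.Nat.sum_antidiagonal_eq_sum_range_succ_mk]
  exact (geom_sum₂_mul x y (n + 1)).symm

/-- The free Poincaré inequality tested on `f x = x + t * x ^ (n + 1)`. -/
theorem mul_integral_one_add_sq_le {ρ : ℝ} {μ : Measure ℝ}
    (hP : ∀ f : ℝ → ℝ, ContDiff ℝ (⊤ : ℕ∞) f →
      2 * ρ * (∫ p : ℝ × ℝ, ((f p.1 - f p.2) / (p.1 - p.2)) ^ 2 ∂omegaMeasure) ≤
        ∫ x, (deriv f x) ^ 2 ∂μ) (n : ℕ) (t : ℝ) :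
    2 * ρ * (∫ p, (1 + t * ∑ q ∈ Finset.HasAntidiagonal.antidiagonal n, p.1 ^ q.1 * p.2 ^ q.2) ^ 2
        ∂omegaMeasure) ≤
      ∫ x, (1 + t * ((n + 1) * x ^ n)) ^ 2 ∂μ := by
  have hderiv (x : ℝ) : deriv (fun x : ℝ => x + t * x ^ (n + 1)) x = 1 + t * ((n + 1) * x ^ n) := by
    have h := ((hasDerivAt_id x).add ((hasDerivAt_pow (n + 1) x).const_mul t)).deriv
    push_cast at h
    exact h
  have h := hP (fun x => x + t * x ^ (n + 1)) (by fun_prop)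
  simp_rw [hderiv] at h
  convert! h using 2
  refine integral_congr_ae ?_
  filter_upwards [ae_omegaMeasure_fst_ne_snd] with p hp
  have hne : p.1 - p.2 ≠ 0 := sub_ne_zero.mpr hp
  congr 1
  rw [eq_div_iff hne]
  linear_combination -t * pow_succ_sub_pow_succ_eq p.1 p.2 n

theorem integral_one_add_mul_sq {X : Type*} [MeasurableSpace X] {ν : Measure X}
    [IsFiniteMeasure ν] {g : X → ℝ} (hg : Integrable g ν) (hg₂ : Integrable (fun x => g x ^ 2) ν)
    (t : ℝ) : ∫ x, (1 + t * g x) ^ 2 ∂ν =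
      ∫ _, (1 : ℝ) ∂ν + 2 * t * ∫ x, g x ∂ν + t ^ 2 * ∫ x, g x ^ 2 ∂ν := by
  rw [← integral_const_mul, ← integral_const_mul,
    ← integral_add (integrable_const _) (hg.const_mul _),
    ← integral_add (f := fun x => 1 + 2 * t * g x) ((integrable_const _).add (hg.const_mul _)) (hg₂.const_mul _)]
  congr 1 with x
  ring

/-- If a probability measure `μ` on `[-2,2]` satisfies the free Poincaré inequality
`2ρ ∬ ((f(x)-f(y))/(x-y))² dω ≤ ∫ (f')² dμ` for all smooth `f`, with `ρ > 0`,
then `ρ ≤ 1/2`, with equality forcing `μ` to be the semicircle law. -/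
theorem free_poincare_constant_le_half (ρ : ℝ) (hρ : 0 < ρ) (μ : Measure ℝ)
    [IsProbabilityMeasure μ] (hsupp : μ (Set.Icc (-2 : ℝ) 2) = 1)
    (hP : ∀ f : ℝ → ℝ, ContDiff ℝ (⊤ : ℕ∞) f →
      2 * ρ * (∫ p : ℝ × ℝ, ((f p.1 - f p.2) / (p.1 - p.2)) ^ 2 ∂omegaMeasure) ≤
        ∫ x, (deriv f x) ^ 2 ∂μ) :
    ρ ≤ 1 / 2 ∧ (ρ = 1 / 2 → μ = semicircleLaw) := by
  have hμ : ∀ᵐ x ∂μ, x ∈ Set.Icc (-2 : ℝ) 2 :=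
    (mem_ae_iff_prob_eq_one measurableSet_Icc).mpr hsupp
  have hle : ρ ≤ 1 / 2 := by
    have h := mul_integral_one_add_sq_le hP 0 0
    simp only [zero_mul, add_zero, one_pow] at h
    rw [integral_one_omegaMeasure, integral_const, probReal_univ] at h
    norm_num at h
    linarith
  refine ⟨hle, ?_⟩
  rintro rfl
  refine Measure.ext_of_forall_moment_eq hμ ae_semicircleLaw_mem_Icc fun n => ?_
  have hint {f : ℝ → ℝ} (hf : Continuous f) : Integrable f μ :=
    hf.integrable_of_ae_mem_isCompact isCompact_Icc hμ
  have h := mul_integral_one_add_sq_le hP n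
  simp_rw [integral_one_add_mul_sq (Continuous.integrable_omegaMeasure
      (f := fun p => ∑ q ∈ Finset.HasAntidiagonal.antidiagonal n, p.1 ^ q.1 * p.2 ^ q.2) (by fun_prop))
      (Continuous.integrable_omegaMeasure (by fun_prop)),
    integral_one_add_mul_sq (hint (f := fun x => (n + 1) * x ^ n) (by fun_prop))
      (hint (by fun_prop)),
    integral_one_omegaMeasure, integral_sum_antidiagonal_omegaMeasure,
    ← integral_pow_semicircleLaw, integral_const_mul] at h
  simp only [integral_const, probReal_univ, smul_eq_mul, mul_one] at h
  have hn : (n + 1 : ℝ) ≠ 0 := by positivity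
  have key := eq_zero_of_forall_mul_add_sq_mul_nonpos
    (a := 2 * ((n + 1) * ∫ x, x ^ n ∂semicircleLaw - (n + 1) * ∫ x, x ^ n ∂μ))
    (b := ∫ p, (∑ q ∈ Finset.HasAntidiagonal.antidiagonal n, p.1 ^ q.1 * p.2 ^ q.2) ^ 2 ∂omegaMeasure
      - ∫ x, ((n + 1) * x ^ n) ^ 2 ∂μ) fun t => by linarith [h t]
  apply mul_left_cancel₀ hn
  linarith
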